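/- W(X,Γ) satisfies axiom (W6): for all a', a, b, c ∈ K(X,Γ) with a' ≺ a and a ≺ b + c, there exist e, f ∈ K(X,Γ) such that a' ≺ e + f, e ≺ a, e ≺ b, f ≺ a and f ≺ c. -/

import Mathlib

open Pointwise TopologicalSpace

/-- The dynamical subequivalence relation `a ≼ b` on tuples (lists) of open subsets of `X`:
for every choice of compact sets `F i ⊆ a.get i` there are, for each `i`, finitely many
open sets `U i j` covering `F i`, group elements `s i j` and indices `k i j` such that
`s i j • U i j ⊆ b.get (k i j)` and the translates landing in the same component are
pairwise disjoint. -/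
def DynSubeq (Γ : Type*) [Group Γ] {X : Type*} [TopologicalSpace X] [MulAction Γ X]
    (a b : List (Opens X)) : Prop :=
  ∀ F : Fin a.length → Set X,
    (∀ i, IsCompact (F i)) → (∀ i, F i ⊆ (a.get i : Set X)) →
    ∃ (J : Fin a.length → ℕ)
      (U : (i : Fin a.length) → Fin (J i) → Set X)
      (s : (i : Fin a.length) → Fin (J i) → Γ)
      (k : (i : Fin a.length) → Fin (J i) → Fin b.length),
      (∀ i j, IsOpen (U i j)) ∧
      (∀ i, F i ⊆ ⋃ j, U i j) ∧
      (∀ i j, s i j • U i j ⊆ (b.get (k i j) : Set X)) ∧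
      (∀ (i : Fin a.length) (j : Fin (J i)) (i' : Fin a.length) (j' : Fin (J i')),
        (i.val, j.val) ≠ (i'.val, j'.val) → k i j = k i' j' →
        Disjoint (s i j • U i j) (s i' j' • U i' j'))

/-- The way-below relation `a ≪ b` on tuples of open subsets of `X`: the tuples have the
same length and each entry of `a` has compact closure contained in the corresponding
entry of `b`. -/
def DynWB {X : Type*} [TopologicalSpace X] (a b : List (Opens X)) : Prop :=
  ∃ h : a.length = b.length, ∀ i : Fin a.length,
    IsCompact (closure ((a.get i) : Set X)) ∧
    closure ((a.get i) : Set X) ⊆ ((b.get (Fin.cast h i)) : Set X)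

/-- The auxiliary relation `a ≺ b`: there is `c` with `a ≼ c ≪ b`. -/
def DynAux (Γ : Type*) [Group Γ] {X : Type*} [TopologicalSpace X] [MulAction Γ X]
    (a b : List (Opens X)) : Prop :=
  ∃ c : List (Opens X), DynSubeq Γ a c ∧ DynWB c b

theorem val_pair_ne_of_sigma_ne {n : ℕ} {J : Fin n → ℕ} {i i' : Fin n} {j : Fin (J i)}
    {j' : Fin (J i')} (h : (⟨i, j⟩ : Σ i, Fin (J i)) ≠ ⟨i', j'⟩) :
    (i.val, j.val) ≠ (i'.val, j'.val) := by
  intro heq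
  obtain ⟨h₁, h₂⟩ := Prod.mk_inj.1 heq
  obtain rfl := Fin.ext h₁
  obtain rfl := Fin.ext h₂
  exact h rfl

/-- To prove `a ≼ b`, the pieces over each entry of `a` may be indexed by arbitrary finite types. -/
theorem DynSubeq.of_finite {Γ : Type*} [Group Γ] {X : Type*} [TopologicalSpace X]
    [MulAction Γ X] {a b : List (Opens X)}
    (h : ∀ F : Fin a.length → Set X,
      (∀ i, IsCompact (F i)) → (∀ i, F i ⊆ (a.get i : Set X)) →
      ∃ (ι : Fin a.length → Type) (_ : ∀ i, Finite (ι i)) (U : ∀ i, ι i → Set X)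
        (s : ∀ i, ι i → Γ) (k : ∀ i, ι i → Fin b.length),
        (∀ i j, IsOpen (U i j)) ∧ (∀ i, F i ⊆ ⋃ j, U i j) ∧
        (∀ i j, s i j • U i j ⊆ (b.get (k i j) : Set X)) ∧
        (∀ p q : Σ i, ι i, p ≠ q → k p.1 p.2 = k q.1 q.2 →
          Disjoint (s p.1 p.2 • U p.1 p.2) (s q.1 q.2 • U q.1 q.2))) :
    DynSubeq Γ a b := by
  intro F hF hFa
  obtain ⟨ι, _, U, s, k, hU, hcov, hsub, hdisj⟩ := h F hF hFa
  let φ := fun i => (Finite.equivFin (ι i)).symm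
  refine ⟨fun i => Nat.card (ι i), fun i j => U i (φ i j), fun i j => s i (φ i j),
    fun i j => k i (φ i j), fun i j => hU _ _, fun i => ?_, fun i j => hsub _ _, ?_⟩
  · rw [(φ i).surjective.iUnion_comp (U i)]
    exact hcov i
  · intro i j i' j' hne hk
    refine hdisj ⟨i, φ i j⟩ ⟨i', φ i' j'⟩ (fun heq => hne ?_) hk
    obtain ⟨rfl, h2⟩ := Sigma.mk.inj_iff.1 heq
    rw [(φ i).injective (eq_of_heq h2)]

/-- A single family of pieces covering the entries of `a` witnesses `a ≼ b`. -/
theorem DynSubeq.of_cover {Γ : Type*} [Group Γ] {X : Type*} [TopologicalSpace X]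
    [MulAction Γ X] {n : ℕ} {a : Fin n → Opens X} {b : List (Opens X)}
    (ι : Fin n → Type) [∀ i, Finite (ι i)] (U : ∀ i, ι i → Set X)
    (s : ∀ i, ι i → Γ) (k : ∀ i, ι i → Fin b.length)
    (hU : ∀ i j, IsOpen (U i j)) (hcov : ∀ i, (a i : Set X) ⊆ ⋃ j, U i j)
    (hsub : ∀ i j, s i j • U i j ⊆ (b.get (k i j) : Set X))
    (hdisj : ∀ p q : Σ i, ι i, p ≠ q → k p.1 p.2 = k q.1 q.2 →
      Disjoint (s p.1 p.2 • U p.1 p.2) (s q.1 q.2 • U q.1 q.2)) :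
    DynSubeq Γ (List.ofFn a) b := by
  obtain ⟨l, hl⟩ : ∃ l, l = List.ofFn a := ⟨_, rfl⟩
  have hlen : l.length = n := by simp [hl]
  have hget : ∀ i, l.get (Fin.cast hlen.symm i) = a i := by
    subst hl
    simp
  rw [← hl]
  subst hlen
  exact .of_finite fun F _ hFa => ⟨ι, inferInstance, U, s, k, hU,
    fun i => (hFa i).trans ((congrArg SetLike.coe (hget i)).subset.trans (hcov i)), hsub, hdisj⟩

theorem DynSubeq.ofFn_mono {Γ : Type*} [Group Γ] {X : Type*} [TopologicalSpace X]
    [MulAction Γ X] {n : ℕ} {a b : Fin n → Opens X} (h : ∀ i, a i ≤ b i) :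
    DynSubeq Γ (List.ofFn a) (List.ofFn b) := by
  refine .of_cover (fun _ => Unit) (fun i _ => a i) (fun _ _ => 1)
    (fun i _ => Fin.cast (by simp) i) (fun i _ => (a i).isOpen)
    (fun i => Set.subset_iUnion (fun _ : Unit => (a i : Set X)) ()) (fun i _ => ?_) ?_
  · simpa using h i
  · rintro ⟨i, _⟩ ⟨i', _⟩ hne hk
    exact absurd (by simpa using hk) (fun hi : i = i' => hne (by rw [hi]))

theorem DynWB.ofFn {X : Type*} [TopologicalSpace X] {n : ℕ} {a b : Fin n → Opens X}
    (h : ∀ i, IsCompact (closure (a i : Set X)) ∧ closure (a i : Set X) ⊆ b i) :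
    DynWB (List.ofFn a) (List.ofFn b) :=
  ⟨by simp, fun i => by
    rw [List.get_ofFn, List.get_ofFn]
    exact h (Fin.cast (by simp) i)⟩

theorem dynWB_iff_forall₂ {X : Type*} [TopologicalSpace X] {a b : List (Opens X)} :
    DynWB a b ↔ List.Forall₂
      (fun O V : Opens X => IsCompact (closure (O : Set X)) ∧ closure (O : Set X) ⊆ V) a b := by
  rw [List.forall₂_iff_get]
  constructor
  · rintro ⟨h, H⟩
    exact ⟨h, fun i hi _ => H ⟨i, hi⟩⟩
  · rintro ⟨h, H⟩
    exact ⟨h, fun i => H i i.2 (h ▸ i.2)⟩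

theorem DynWB.append {X : Type*} [TopologicalSpace X] {a b c d : List (Opens X)}
    (h : DynWB a b) (h' : DynWB c d) : DynWB (a ++ c) (b ++ d) := by
  rw [dynWB_iff_forall₂] at *
  exact List.rel_append h h'

theorem DynWB.exists_append {X : Type*} [TopologicalSpace X] {d b c : List (Opens X)}
    (h : DynWB d (b ++ c)) : ∃ d₁ d₂, d = d₁ ++ d₂ ∧ DynWB d₁ b ∧ DynWB d₂ c := by
  simp only [dynWB_iff_forall₂] at *
  exact ⟨d.take b.length, d.drop b.length, (List.take_append_drop _ _).symm,
    List.forall₂_take_append _ _ _ h, List.forall₂_drop_append _ _ _ h⟩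

/-- If each entry of `b` is covered by the corresponding entries of `e` and `f`, then `a ≼ b`
implies `a ≼ e + f`. -/
theorem DynSubeq.trans_sup {Γ : Type*} [Group Γ] {X : Type*} [TopologicalSpace X]
    [MulAction Γ X] [ContinuousConstSMul Γ X] {a b : List (Opens X)} (h : DynSubeq Γ a b)
    {n : ℕ} (hn : b.length = n) {e f : Fin n → Opens X}
    (hef : ∀ i, b.get i ≤ e (Fin.cast hn i) ⊔ f (Fin.cast hn i)) :
    DynSubeq Γ a (List.ofFn e ++ List.ofFn f) := by
  subst hn
  refine .of_finite fun F hF hFa => ?_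
  obtain ⟨J, U, s, k, hU, hcov, hsub, hdisj⟩ := h F hF hFa
  let V : ∀ i, Fin (J i) × Bool → Set X := fun i j =>
    U i j.1 ∩ (s i j.1)⁻¹ • (if j.2 then (e (k i j.1) : Set X) else f (k i j.1))
  let l : ∀ i, Fin (J i) × Bool → Fin (List.ofFn e ++ List.ofFn f).length := fun i j =>
    if j.2 then ⟨k i j.1, by simp; omega⟩ else ⟨b.length + k i j.1, by simp⟩
  refine ⟨fun i => Fin (J i) × Bool, inferInstance, V, fun i j => s i j.1, l, ?_, ?_, ?_, ?_⟩
  · rintro i ⟨j, _ | _⟩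
    · exact (hU i j).inter ((f (k i j)).isOpen.smul _)
    · exact (hU i j).inter ((e (k i j)).isOpen.smul _)
  · intro i x hx
    obtain ⟨j, hj⟩ := Set.mem_iUnion.1 (hcov i hx)
    rcases hef _ (hsub i j (Set.smul_mem_smul_set hj)) with h' | h'
    · exact Set.mem_iUnion.2 ⟨(j, true), hj, Set.mem_inv_smul_set_iff.2 h'⟩
    · exact Set.mem_iUnion.2 ⟨(j, false), hj, Set.mem_inv_smul_set_iff.2 h'⟩
  · rintro i ⟨j, _ | _⟩ _ ⟨x, ⟨_, hx⟩, rfl⟩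
    · simpa [l, Set.mem_inv_smul_set_iff] using hx
    · simpa [l, Set.mem_inv_smul_set_iff, List.getElem_append_left] using hx
  · rintro ⟨i, j, t⟩ ⟨i', j', t'⟩ hne hk
    have key : t = t' ∧ k i j = k i' j' := by
      have := congrArg Fin.val hk
      cases t <;> cases t' <;> simp [l] at this ⊢ <;> omega
    obtain ⟨rfl, hk'⟩ := key
    refine (hdisj i j i' j' (val_pair_ne_of_sigma_ne fun heq => hne ?_) hk').mono
      (Set.smul_set_mono Set.inter_subset_left) (Set.smul_set_mono Set.inter_subset_left)
    cases heq
    rfl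

/-- `W(X, Γ)` satisfies axiom (W6). -/
theorem dynW_satW6 {X : Type*} [TopologicalSpace X] [LocallyCompactSpace X] [T2Space X]
    [SecondCountableTopology X] {Γ : Type*} [Group Γ] [Countable Γ] [Infinite Γ]
    [MulAction Γ X] [ContinuousConstSMul Γ X]
    (a' a b c : List (Opens X)) (h1 : DynAux Γ a' a) (h2 : DynAux Γ a (b ++ c)) :
    ∃ e f : List (Opens X), DynAux Γ a' (e ++ f) ∧
      DynAux Γ e a ∧ DynAux Γ e b ∧ DynAux Γ f a ∧ DynAux Γ f c := by
  obtain ⟨a₀, ha', hlen, hwb⟩ := h1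
  obtain ⟨d, had, hd⟩ := h2
  obtain ⟨d₁, d₂, rfl, hd₁, hd₂⟩ := hd.exists_append
  set n := a.length
  let K : Fin n → Set X := fun i => closure (a₀.get (Fin.cast hlen.symm i) : Set X)
  have hK : ∀ i, IsCompact (K i) := fun i => (hwb _).1
  have hKa : ∀ i, K i ⊆ (a.get i : Set X) := fun i => (hwb (Fin.cast hlen.symm i)).2
  obtain ⟨J, U, s, k, hU, hcov, hsub, hdisj⟩ := had K hK hKa
  have hdisj' : ∀ p q : Σ i, Fin (J i), p ≠ q → k p.1 p.2 = k q.1 q.2 →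
      Disjoint (s p.1 p.2 • U p.1 p.2) (s q.1 q.2 • U q.1 q.2) := by
    rintro ⟨i, j⟩ ⟨i', j'⟩ hne hk
    exact hdisj i j i' j' (val_pair_ne_of_sigma_ne hne) hk
  choose W hWo hKW hWa hWc using fun i =>
    exists_open_between_and_isCompact_closure (hK i) (a.get i).isOpen (hKa i)
  let P : ∀ i, Fin (J i) → Prop := fun i j => (k i j).val < d₁.length
  let e : Fin n → Opens X := fun i =>
    ⟨W i ∩ ⋃ j : {j // P i j}, U i j, (hWo i).inter (isOpen_iUnion fun j => hU i j)⟩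
  let f : Fin n → Opens X := fun i =>
    ⟨W i ∩ ⋃ j : {j // ¬ P i j}, U i j, (hWo i).inter (isOpen_iUnion fun j => hU i j)⟩
  have hKef : ∀ i, K i ⊆ (e i : Set X) ∪ f i := by
    intro i x hx
    obtain ⟨j, hj⟩ := Set.mem_iUnion.1 (hcov i hx)
    by_cases hP : P i j
    · exact Or.inl ⟨hKW i hx, Set.mem_iUnion.2 ⟨⟨j, hP⟩, hj⟩⟩
    · exact Or.inr ⟨hKW i hx, Set.mem_iUnion.2 ⟨⟨j, hP⟩, hj⟩⟩
  choose K₁ K₂ hK₁ hK₂ hK₁e hK₂f hKeq using fun i =>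
    (hK i).binary_compact_cover (e i).isOpen (f i).isOpen (hKef i)
  choose e' he'o hKe' he'e he'c using fun i =>
    exists_open_between_and_isCompact_closure (hK₁ i) (e i).isOpen (hK₁e i)
  choose f' hf'o hKf' hf'f hf'c using fun i =>
    exists_open_between_and_isCompact_closure (hK₂ i) (f i).isOpen (hK₂f i)
  have hWB : DynWB (List.ofFn fun i => (⟨W i, hWo i⟩ : Opens X)) a := by
    have := DynWB.ofFn (a := fun i => (⟨W i, hWo i⟩ : Opens X)) (b := a.get)
      fun i => ⟨hWc i, hWa i⟩
    rwa [List.ofFn_get] at this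
  refine ⟨List.ofFn e, List.ofFn f,
    ⟨List.ofFn (fun i => (⟨e' i, he'o i⟩ : Opens X)) ++
      List.ofFn (fun i => (⟨f' i, hf'o i⟩ : Opens X)), ha'.trans_sup hlen fun i x hx => ?_,
      (DynWB.ofFn fun i => ⟨he'c i, he'e i⟩).append (DynWB.ofFn fun i => ⟨hf'c i, hf'f i⟩)⟩,
    ⟨_, .ofFn_mono fun i => Set.inter_subset_left, hWB⟩, ⟨d₁, ?_, hd₁⟩,
    ⟨_, .ofFn_mono fun i => Set.inter_subset_left, hWB⟩, ⟨d₂, ?_, hd₂⟩⟩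
  · have hx' : x ∈ K (Fin.cast hlen i) := subset_closure hx
    rw [hKeq] at hx'
    exact hx'.imp (fun h => hKe' _ h) (fun h => hKf' _ h)
  · refine .of_cover (fun i => {j // P i j}) (fun i j => U i j) (fun i j => s i j)
      (fun i j => ⟨k i j, j.2⟩) (fun i j => hU _ _) (fun i => Set.inter_subset_right)
      (fun i j => ?_) ?_
    · have := hsub i j
      rwa [List.get_eq_getElem, List.getElem_append_left j.2] at this
    · rintro ⟨i, j, hj⟩ ⟨i', j', hj'⟩ hne hk
      refine hdisj' ⟨i, j⟩ ⟨i', j'⟩ (fun heq => hne ?_) (Fin.ext (congrArg Fin.val hk :))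
      cases heq
      rfl
  · refine .of_cover (fun i => {j // ¬ P i j}) (fun i j => U i j) (fun i j => s i j)
      (fun i j => ⟨k i j - d₁.length, ?_⟩) (fun i j => hU _ _) (fun i => Set.inter_subset_right)
      (fun i j => ?_) ?_
    · have h1 := (k i j).2.trans_eq List.length_append
      have h2 : ¬ (k i j).val < d₁.length := j.2
      omega
    · have := hsub i j
      rwa [List.get_eq_getElem, List.getElem_append_right (not_lt.1 j.2)] at this
    · rintro ⟨i, j, hj⟩ ⟨i', j', hj'⟩ hne hk
      have hk' : (k i j).val - d₁.length = (k i' j').val - d₁.length := congrArg Fin.val hk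
      have h1 : ¬ (k i j).val < d₁.length := hj
      have h2 : ¬ (k i' j').val < d₁.length := hj'
      refine hdisj' ⟨i, j⟩ ⟨i', j'⟩ (fun heq => hne ?_) (Fin.ext (by dsimp only; omega))
      cases heq
      rfl
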